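/- Let ψ be a nonzero real quartic spinor (ψ† = ψ) satisfying I(ψ)³ = 6·J(ψ)². Then there exist a real quadratic spinor Θ (Θ† = Θ) with ⟨Θ,Θ⟩ ≠ 0 and a nonzero real number c such that ψ = c·(Θ⊙Θ); that is, in Riemannian signature the condition I³ = 6J² forces a nonzero self-dual Weyl spinor to be of algebraic type D with a real non-null repeated spinor factor. -/

import Mathlib

noncomputable section

open Finset

/-- The symplectic array ε with ε₀₁ = 1, ε₁₀ = −1, ε₀₀ = ε₁₁ = 0.
The same array is used with upper indices. -/
def eps : Fin 2 → Fin 2 → ℂ := ![![0, 1], ![-1, 0]]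

/-- A quartic spinor: invariance under all permutations of its four arguments
(equivalently, under the adjacent transpositions, which generate S₄). -/
def IsQuartic (ψ : Fin 2 → Fin 2 → Fin 2 → Fin 2 → ℂ) : Prop :=
  ∀ A B C D : Fin 2,
    ψ A B C D = ψ B A C D ∧ ψ A B C D = ψ A C B D ∧ ψ A B C D = ψ A B D C

/-- A quadratic spinor: a symmetric map. -/
def IsQuadratic (ω : Fin 2 → Fin 2 → ℂ) : Prop := ∀ A B : Fin 2, ω A B = ω B A

/-- ⟨ψ,ψ⟩ for a quartic spinor. -/
def quarticInner (ψ : Fin 2 → Fin 2 → Fin 2 → Fin 2 → ℂ) : ℂ :=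
  ∑ A, ∑ B, ∑ C, ∑ D, ∑ A1, ∑ B1, ∑ C1, ∑ D1,
    eps A A1 * eps B B1 * eps C C1 * eps D D1 * ψ A B C D * ψ A1 B1 C1 D1

/-- ⟨ω,ω⟩ for a quadratic spinor. -/
def quadInner (ω : Fin 2 → Fin 2 → ℂ) : ℂ :=
  ∑ A, ∑ B, ∑ A1, ∑ B1, eps A A1 * eps B B1 * ω A B * ω A1 B1

/-- The symmetrized square (ω⊙ω) of a quadratic spinor. -/
def symSq (ω : Fin 2 → Fin 2 → ℂ) : Fin 2 → Fin 2 → Fin 2 → Fin 2 → ℂ :=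
  fun A B C D => (1/3 : ℂ) * (ω A B * ω C D + ω A C * ω B D + ω A D * ω B C)

/-- The algebraic Kähler condition:
∑_σ ∑_{E,F} ε^{EF} ψ_{F σ(A) σ(B) σ(C)} ω_{σ(D) E} = 0 for all A,B,C,D. -/
def AlgKahler (ψ : Fin 2 → Fin 2 → Fin 2 → Fin 2 → ℂ) (ω : Fin 2 → Fin 2 → ℂ) : Prop :=
  ∀ A B C D : Fin 2,
    ∑ σ : Equiv.Perm (Fin 4), ∑ E, ∑ F,
      eps E F * ψ F (![A, B, C, D] (σ 0)) (![A, B, C, D] (σ 1)) (![A, B, C, D] (σ 2)) *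
        ω (![A, B, C, D] (σ 3)) E = 0

/-- The invariant I(ψ) = ⟨ψ,ψ⟩. -/
def Ipsi (ψ : Fin 2 → Fin 2 → Fin 2 → Fin 2 → ℂ) : ℂ := quarticInner ψ

/-- The invariant J(ψ). -/
def Jpsi (ψ : Fin 2 → Fin 2 → Fin 2 → Fin 2 → ℂ) : ℂ :=
  ∑ A, ∑ B, ∑ C, ∑ D, ∑ E, ∑ F, ∑ A1, ∑ B1, ∑ C1, ∑ D1, ∑ E1, ∑ F1,
    eps C C1 * eps D D1 * eps E E1 * eps F F1 * eps A A1 * eps B B1 *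
      ψ A B C1 D1 * ψ C D E1 F1 * ψ E F A1 B1

/-- The Riemannian conjugate ψ† of a quartic spinor. -/
def quarticDagger (ψ : Fin 2 → Fin 2 → Fin 2 → Fin 2 → ℂ) :
    Fin 2 → Fin 2 → Fin 2 → Fin 2 → ℂ :=
  fun A B C D =>
    (-1 : ℂ) ^ (A.val + B.val + C.val + D.val) *
      (starRingEnd ℂ) (ψ (1 - A) (1 - B) (1 - C) (1 - D))

/-- The Riemannian conjugate ω† of a quadratic spinor. -/
def quadDagger (ω : Fin 2 → Fin 2 → ℂ) : Fin 2 → Fin 2 → ℂ :=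
  fun A B => (-1 : ℂ) ^ (A.val + B.val) * (starRingEnd ℂ) (ω (1 - A) (1 - B))

/-- The binary quartic p_ψ(x,y) associated to a quartic spinor, with π⁰ = x = X 0, π¹ = y = X 1. -/
def binaryQuartic (ψ : Fin 2 → Fin 2 → Fin 2 → Fin 2 → ℂ) : MvPolynomial (Fin 2) ℂ :=
  ∑ A, ∑ B, ∑ C, ∑ D,
    MvPolynomial.C (ψ A B C D) * MvPolynomial.X A * MvPolynomial.X B *
      MvPolynomial.X C * MvPolynomial.X D

lemma rankOne_aux (x y z u v w : ℝ) (hx : y * z = w ^ 2) (hy : x * z = v ^ 2)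
    (hz : x * y = u ^ 2) (hu : u * z = v * w) (hv : v * y = u * w) (hw : w * x = u * v)
    (hne : x + y + z ≠ 0) :
    ∃ α β γ k : ℝ, k ≠ 0 ∧ α ^ 2 + β ^ 2 + γ ^ 2 ≠ 0 ∧ x = k * α ^ 2 ∧ y = k * β ^ 2 ∧
      z = k * γ ^ 2 ∧ u = k * (α * β) ∧ v = k * (α * γ) ∧ w = k * (β * γ) := by
  by_cases h1 : x = 0
  · by_cases h2 : y = 0
    · have h3 : z ≠ 0 := by
        intro h3; apply hne; simp [h1, h2, h3]
      refine ⟨v, w, z, 1 / z, by positivity, by positivity, ?_, ?_, ?_, ?_, ?_, ?_⟩ <;>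
        field_simp <;> linarith
    · refine ⟨u, y, w, 1 / y, by positivity, by positivity, ?_, ?_, ?_, ?_, ?_, ?_⟩ <;>
        field_simp <;> linarith
  · refine ⟨x, u, v, 1 / x, by positivity, by positivity, ?_, ?_, ?_, ?_, ?_, ?_⟩ <;>
      field_simp <;> linarith

/-- A nonzero traceless real symmetric matrix with vanishing discriminant is, up to a multiple of
the identity, of rank one. -/
lemma traceless_aux (x y z u v w T2 T3 : ℝ) (htr : x + y + z = 0)
    (hT2 : T2 = x ^ 2 + y ^ 2 + z ^ 2 + 2 * u ^ 2 + 2 * v ^ 2 + 2 * w ^ 2)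
    (hT3 : T3 = x ^ 3 + y ^ 3 + z ^ 3 + 3 * x * (u ^ 2 + v ^ 2) + 3 * y * (u ^ 2 + w ^ 2)
      + 3 * z * (v ^ 2 + w ^ 2) + 6 * u * v * w)
    (hT : T2 ^ 3 = 6 * T3 ^ 2) (hne : T2 ≠ 0) :
    ∃ α β γ k m : ℝ, k ≠ 0 ∧ α ^ 2 + β ^ 2 + γ ^ 2 ≠ 0 ∧ x - m = k * α ^ 2 ∧ y - m = k * β ^ 2 ∧
      z - m = k * γ ^ 2 ∧ u = k * (α * β) ∧ v = k * (α * γ) ∧ w = k * (β * γ) := by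
  obtain ⟨m, hm⟩ : ∃ m, m = - T3 / T2 := ⟨_, rfl⟩
  have h2 : T2 = 6 * m ^ 2 := by
    rw [hm]; field_simp; linarith
  have h3 : T3 = - 6 * m ^ 3 := by
    have : T3 = - m * T2 := by rw [hm]; field_simp
    rw [this, h2]; ring
  have hm0 : m ≠ 0 := by
    intro h; apply hne; rw [h2, h]; ring
  obtain rfl : z = - x - y := by linarith
  have key : (x ^ 2 + u ^ 2 + v ^ 2 + m * x - 2 * m ^ 2) ^ 2
      + (y ^ 2 + u ^ 2 + w ^ 2 + m * y - 2 * m ^ 2) ^ 2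
      + ((- x - y) ^ 2 + v ^ 2 + w ^ 2 + m * (- x - y) - 2 * m ^ 2) ^ 2
      + 2 * (x * u + u * y + v * w + m * u) ^ 2
      + 2 * (x * v + u * w + v * (- x - y) + m * v) ^ 2
      + 2 * (u * v + y * w + w * (- x - y) + m * w) ^ 2 = 0 := by
    have e2 : T2 ^ 2 / 2 + 2 * m * T3 - 3 * m ^ 2 * T2 + 12 * m ^ 4 = 0 := by
      rw [h2, h3]; ring
    rw [← e2, hT2, hT3]
    ring
  have s1 := sq_nonneg (x ^ 2 + u ^ 2 + v ^ 2 + m * x - 2 * m ^ 2)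
  have s2 := sq_nonneg (y ^ 2 + u ^ 2 + w ^ 2 + m * y - 2 * m ^ 2)
  have s3 := sq_nonneg ((- x - y) ^ 2 + v ^ 2 + w ^ 2 + m * (- x - y) - 2 * m ^ 2)
  have s4 := sq_nonneg (x * u + u * y + v * w + m * u)
  have s5 := sq_nonneg (x * v + u * w + v * (- x - y) + m * v)
  have s6 := sq_nonneg (u * v + y * w + w * (- x - y) + m * w)
  have k1 := pow_eq_zero_iff (two_ne_zero) |>.1 (le_antisymm (by linarith) s1)
  have k2 := pow_eq_zero_iff (two_ne_zero) |>.1 (le_antisymm (by linarith) s2)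
  have k3 := pow_eq_zero_iff (two_ne_zero) |>.1 (le_antisymm (by linarith) s3)
  have k4 := pow_eq_zero_iff (two_ne_zero) |>.1 (le_antisymm (by linarith) s4)
  have k5 := pow_eq_zero_iff (two_ne_zero) |>.1 (le_antisymm (by linarith) s5)
  have k6 := pow_eq_zero_iff (two_ne_zero) |>.1 (le_antisymm (by linarith) s6)
  rw [hT2] at h2
  obtain ⟨α, β, γ, k, h⟩ := rankOne_aux (x - m) (y - m) (- x - y - m) u v w
    (by linear_combination k1 - h2 / 2) (by linear_combination k2 - h2 / 2)
    (by linear_combination k3 - h2 / 2)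
    (by linear_combination -k4) (by linear_combination -k5) (by linear_combination -k6)
    (by intro h; apply hm0; linarith)
  exact ⟨α, β, γ, k, m, h⟩

lemma Ipsi_formula (ψ : Fin 2 → Fin 2 → Fin 2 → Fin 2 → ℂ) (hψ : IsQuartic ψ) :
    Ipsi ψ = 2 * ψ 0 0 0 0 * ψ 1 1 1 1 - 8 * ψ 0 0 0 1 * ψ 0 1 1 1 + 6 * ψ 0 0 1 1 ^ 2 := by
  have p1 : ψ 0 0 1 0 = ψ 0 0 0 1 := (hψ 0 0 1 0).2.2
  have p2 : ψ 0 1 0 0 = ψ 0 0 0 1 := (hψ 0 1 0 0).2.1.trans p1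
  have p3 : ψ 1 0 0 0 = ψ 0 0 0 1 := (hψ 1 0 0 0).1.trans p2
  have q1 : ψ 0 1 0 1 = ψ 0 0 1 1 := (hψ 0 1 0 1).2.1
  have q2 : ψ 1 0 0 1 = ψ 0 0 1 1 := (hψ 1 0 0 1).1.trans q1
  have q3 : ψ 0 1 1 0 = ψ 0 0 1 1 := (hψ 0 1 1 0).2.2.trans q1
  have q4 : ψ 1 0 1 0 = ψ 0 0 1 1 := (hψ 1 0 1 0).1.trans q3
  have q5 : ψ 1 1 0 0 = ψ 0 0 1 1 := (hψ 1 1 0 0).2.1.trans q4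
  have r1 : ψ 1 0 1 1 = ψ 0 1 1 1 := (hψ 1 0 1 1).1
  have r2 : ψ 1 1 0 1 = ψ 0 1 1 1 := (hψ 1 1 0 1).2.1.trans r1
  have r3 : ψ 1 1 1 0 = ψ 0 1 1 1 := (hψ 1 1 1 0).2.2.trans r2
  simp [Ipsi, quarticInner, eps, Fin.sum_univ_two, p1, p2, p3, q1, q2, q3, q4, q5, r1, r2, r3]
  ring

lemma Jpsi_formula (ψ : Fin 2 → Fin 2 → Fin 2 → Fin 2 → ℂ) (hψ : IsQuartic ψ) :
    Jpsi ψ = 6 * (ψ 0 0 0 0 * ψ 0 0 1 1 * ψ 1 1 1 1 + 2 * ψ 0 0 0 1 * ψ 0 0 1 1 * ψ 0 1 1 1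
      - ψ 0 0 0 0 * ψ 0 1 1 1 ^ 2 - ψ 0 0 0 1 ^ 2 * ψ 1 1 1 1 - ψ 0 0 1 1 ^ 3) := by
  have p1 : ψ 0 0 1 0 = ψ 0 0 0 1 := (hψ 0 0 1 0).2.2
  have p2 : ψ 0 1 0 0 = ψ 0 0 0 1 := (hψ 0 1 0 0).2.1.trans p1
  have p3 : ψ 1 0 0 0 = ψ 0 0 0 1 := (hψ 1 0 0 0).1.trans p2
  have q1 : ψ 0 1 0 1 = ψ 0 0 1 1 := (hψ 0 1 0 1).2.1
  have q2 : ψ 1 0 0 1 = ψ 0 0 1 1 := (hψ 1 0 0 1).1.trans q1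
  have q3 : ψ 0 1 1 0 = ψ 0 0 1 1 := (hψ 0 1 1 0).2.2.trans q1
  have q4 : ψ 1 0 1 0 = ψ 0 0 1 1 := (hψ 1 0 1 0).1.trans q3
  have q5 : ψ 1 1 0 0 = ψ 0 0 1 1 := (hψ 1 1 0 0).2.1.trans q4
  have r1 : ψ 1 0 1 1 = ψ 0 1 1 1 := (hψ 1 0 1 1).1
  have r2 : ψ 1 1 0 1 = ψ 0 1 1 1 := (hψ 1 1 0 1).2.1.trans r1
  have r3 : ψ 1 1 1 0 = ψ 0 1 1 1 := (hψ 1 1 1 0).2.2.trans r2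
  simp [Jpsi, eps, Fin.sum_univ_two, p1, p2, p3, q1, q2, q3, q4, q5, r1, r2, r3]
  ring

set_option maxHeartbeats 2000000

/-- a nonzero real quartic spinor with I³ = 6J² is of type D with a real
non-null repeated quadratic spinor factor and a nonzero real coefficient. -/
theorem real_quartic_typeD_of_I_cubed_eq_six_J_squared
    (ψ : Fin 2 → Fin 2 → Fin 2 → Fin 2 → ℂ) (hψ : IsQuartic ψ)
    (hreal : quarticDagger ψ = ψ) (hne : ψ ≠ fun _ _ _ _ => 0)
    (hIJ : Ipsi ψ ^ 3 = 6 * Jpsi ψ ^ 2) :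
    ∃ (Θ : Fin 2 → Fin 2 → ℂ) (c : ℝ), IsQuadratic Θ ∧ quadDagger Θ = Θ ∧
      quadInner Θ ≠ 0 ∧ c ≠ 0 ∧
      ∀ A B C D : Fin 2, ψ A B C D = (c : ℂ) * symSq Θ A B C D := by
  have hI := Ipsi_formula ψ hψ
  have hJ := Jpsi_formula ψ hψ
  have p1 : ψ 0 0 1 0 = ψ 0 0 0 1 := (hψ 0 0 1 0).2.2
  have p2 : ψ 0 1 0 0 = ψ 0 0 0 1 := (hψ 0 1 0 0).2.1.trans p1
  have p3 : ψ 1 0 0 0 = ψ 0 0 0 1 := (hψ 1 0 0 0).1.trans p2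
  have q1 : ψ 0 1 0 1 = ψ 0 0 1 1 := (hψ 0 1 0 1).2.1
  have q2 : ψ 1 0 0 1 = ψ 0 0 1 1 := (hψ 1 0 0 1).1.trans q1
  have q3 : ψ 0 1 1 0 = ψ 0 0 1 1 := (hψ 0 1 1 0).2.2.trans q1
  have q4 : ψ 1 0 1 0 = ψ 0 0 1 1 := (hψ 1 0 1 0).1.trans q3
  have q5 : ψ 1 1 0 0 = ψ 0 0 1 1 := (hψ 1 1 0 0).2.1.trans q4
  have r1 : ψ 1 0 1 1 = ψ 0 1 1 1 := (hψ 1 0 1 1).1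
  have r2 : ψ 1 1 0 1 = ψ 0 1 1 1 := (hψ 1 1 0 1).2.1.trans r1
  have r3 : ψ 1 1 1 0 = ψ 0 1 1 1 := (hψ 1 1 1 0).2.2.trans r2
  have he : (starRingEnd ℂ) (ψ 0 0 0 0) = ψ 1 1 1 1 := by
    have := congrFun (congrFun (congrFun (congrFun hreal 1) 1) 1) 1
    simpa [quarticDagger, pow_succ] using this
  have hd : - (starRingEnd ℂ) (ψ 0 0 0 1) = ψ 0 1 1 1 := by
    have := congrFun (congrFun (congrFun (congrFun hreal 0) 1) 1) 1
    simpa [quarticDagger, p3, pow_succ] using this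
  have hc : (starRingEnd ℂ) (ψ 0 0 1 1) = ψ 0 0 1 1 := by
    have := congrFun (congrFun (congrFun (congrFun hreal 0) 0) 1) 1
    simpa [quarticDagger, q5, pow_succ] using this
  obtain ⟨a1, a2, ha⟩ : ∃ a1 a2 : ℝ, ψ 0 0 0 0 = a1 + a2 * Complex.I :=
    ⟨_, _, (Complex.re_add_im _).symm⟩
  obtain ⟨b1, b2, hb⟩ : ∃ b1 b2 : ℝ, ψ 0 0 0 1 = b1 + b2 * Complex.I :=
    ⟨_, _, (Complex.re_add_im _).symm⟩
  obtain ⟨c, hc⟩ : ∃ c : ℝ, ψ 0 0 1 1 = c := by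
    obtain ⟨r, hr⟩ := Complex.conj_eq_iff_real.1 hc
    exact ⟨r, hr⟩
  have he : ψ 1 1 1 1 = a1 - a2 * Complex.I := by
    rw [← he, ha]; simp [sub_eq_add_neg]
  have hd : ψ 0 1 1 1 = - b1 + b2 * Complex.I := by
    rw [← hd, hb]; simp [add_comm]
  have hI2 : Complex.I ^ 2 = -1 := Complex.I_sq
  obtain ⟨T2, hT2⟩ : ∃ T2 : ℝ, T2 = ((c + a1) / 2) ^ 2 + ((c - a1) / 2) ^ 2 + (-c) ^ 2
    + 2 * (a2 / 2) ^ 2 + 2 * b2 ^ 2 + 2 * (-b1) ^ 2 := ⟨_, rfl⟩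
  obtain ⟨T3, hT3⟩ : ∃ T3 : ℝ, T3 = ((c + a1) / 2) ^ 3 + ((c - a1) / 2) ^ 3 + (-c) ^ 3
      + 3 * ((c + a1) / 2) * ((a2 / 2) ^ 2 + b2 ^ 2) + 3 * ((c - a1) / 2) * ((a2 / 2) ^ 2 + (-b1) ^ 2)
      + 3 * (-c) * (b2 ^ 2 + (-b1) ^ 2) + 6 * (a2 / 2) * b2 * (-b1) := ⟨_, rfl⟩
  have hI' : Ipsi ψ = ((4 * T2 : ℝ) : ℂ) := by
    rw [hI, ha, hb, hc, hd, he, hT2]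
    push_cast
    linear_combination (-2 * (a2 : ℂ) ^ 2 - 8 * (b2 : ℂ) ^ 2) * hI2
  have hJ' : Jpsi ψ = ((8 * T3 : ℝ) : ℂ) := by
    rw [hJ, ha, hb, hc, hd, he, hT3]
    push_cast
    ring_nf
    simp only [hI2]
    ring
  rw [hI', hJ'] at hIJ
  have hIJ' : (4 * T2) ^ 3 = 6 * (8 * T3) ^ 2 := by exact_mod_cast hIJ
  have hne2 : T2 ≠ 0 := by
    intro h0
    apply hne
    rw [hT2] at h0
    have z0 : 3 * c ^ 2 + a1 ^ 2 + a2 ^ 2 + 4 * b1 ^ 2 + 4 * b2 ^ 2 = 0 := by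
      linear_combination 2 * h0
    have z1 : c = 0 := by nlinarith [sq_nonneg a1, sq_nonneg a2, sq_nonneg b1, sq_nonneg b2, sq_nonneg c]
    have z2 : a1 = 0 := by nlinarith [sq_nonneg a1, sq_nonneg a2, sq_nonneg b1, sq_nonneg b2, sq_nonneg c]
    have z3 : a2 = 0 := by nlinarith [sq_nonneg a1, sq_nonneg a2, sq_nonneg b1, sq_nonneg b2, sq_nonneg c]
    have z4 : b1 = 0 := by nlinarith [sq_nonneg a1, sq_nonneg a2, sq_nonneg b1, sq_nonneg b2, sq_nonneg c]
    have z5 : b2 = 0 := by nlinarith [sq_nonneg a1, sq_nonneg a2, sq_nonneg b1, sq_nonneg b2, sq_nonneg c]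
    subst z1 z2 z3 z4 z5
    funext A B C D
    fin_cases A <;> fin_cases B <;> fin_cases C <;> fin_cases D <;>
      simp [p1, p2, p3, q1, q2, q3, q4, q5, r1, r2, r3, ha, hb, hc, hd, he]
  obtain ⟨α, β, γ, k, m, hk, hθ, e1, e2, e3, e4, e5, e6⟩ :=
    traceless_aux _ _ _ _ _ _ T2 T3 (by ring) hT2 hT3 (by linarith) hne2
  have fa1 : a1 = k * (α ^ 2 - β ^ 2) := by linear_combination e1 - e2
  have fa2 : a2 = k * (2 * α * β) := by linear_combination 2 * e4
  have fb1 : b1 = - k * (β * γ) := by linear_combination - e6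
  have fc : c = k * (α ^ 2 + β ^ 2 - 2 * γ ^ 2) / 3 := by
    linear_combination (e1 + e2 - 2 * e3) / 3
  refine ⟨![![α + β * Complex.I, γ * Complex.I], ![γ * Complex.I, α - β * Complex.I]], k,
    ?_, ?_, ?_, hk, ?_⟩
  · intro A B
    fin_cases A <;> fin_cases B <;> simp
  · funext A B
    fin_cases A <;> fin_cases B <;> simp [quadDagger, sub_eq_add_neg]
  · have : quadInner ![![α + β * Complex.I, γ * Complex.I], ![γ * Complex.I, α - β * Complex.I]]
        = ((2 * (α ^ 2 + β ^ 2 + γ ^ 2) : ℝ) : ℂ) := by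
      simp [quadInner, eps, Fin.sum_univ_two]
      linear_combination (-2 * (β : ℂ) ^ 2 - 2 * (γ : ℂ) ^ 2) * hI2
    rw [this]
    exact_mod_cast mul_ne_zero two_ne_zero hθ
  · subst fa1 fa2 fb1 fc e5
    intro A B C D
    fin_cases A <;> fin_cases B <;> fin_cases C <;> fin_cases D <;>
      simp [p1, p2, p3, q1, q2, q3, q4, q5, r1, r2, r3, ha, hb, hc, hd, he, symSq] <;>
      ring_nf <;> simp only [hI2] <;> ring
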